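/- Let f(x) = -1 + x + x^n + x^{m_1} be a quadrinomial in the class B (so n ≥ 3 and m_1 - n ≥ n - 1). Set e_1 = gcd(m_1, n - 1) and e_2 = gcd(n, m_1 - 1). Then f is irreducible over ℚ if and only if m_1 ≢ 0 (mod 2·e_1) and n ≢ 0 (mod 2·e_2). -/

import Mathlib

open Polynomial

/-- The quadrinomial `f(x) = -1 + x + x^n + x^{m₁}` of the class `B`. -/
noncomputable def quad (n m : ℕ) : Polynomial ℚ := -1 + X + X ^ n + X ^ m

/-- The integer quadrinomial `x^m + x^b + x^a - 1`. -/
noncomputable def intQuad (a b m : ℕ) : ℤ[X] := X ^ m + X ^ b + X ^ a - 1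

section intQuad

variable {a b m : ℕ}

lemma coeff_zero_intQuad (ha : 0 < a) (hab : a < b) (hbm : b < m) :
    (intQuad a b m).coeff 0 = -1 := by
  simp [intQuad, coeff_X_pow, coeff_one, ha.ne, (ha.trans hab).ne, (ha.trans (hab.trans hbm)).ne]

lemma natDegree_intQuad (ha : 0 < a) (hab : a < b) (hbm : b < m) :
    (intQuad a b m).natDegree = m := by
  rw [intQuad]
  compute_degree!
  all_goals first | omega | (split_ifs <;> first | omega | simp)

lemma natTrailingDegree_intQuad (ha : 0 < a) (hab : a < b) (hbm : b < m) :
    (intQuad a b m).natTrailingDegree = 0 :=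
  natTrailingDegree_eq_zero.2 (Or.inr (by simp [coeff_zero_intQuad ha hab hbm]))

lemma leadingCoeff_intQuad (ha : 0 < a) (hab : a < b) (hbm : b < m) :
    (intQuad a b m).leadingCoeff = 1 := by
  rw [leadingCoeff, natDegree_intQuad ha hab hbm, intQuad]
  simp [coeff_X_pow, coeff_one, (hab.trans hbm).ne', hbm.ne', (ha.trans (hab.trans hbm)).ne']

lemma mirror_intQuad (ha : 0 < a) (hab : a < b) (hbm : b < m) :
    (intQuad a b m).mirror = 1 + X ^ (m - b) + X ^ (m - a) - X ^ m := by
  have h : intQuad a b m = C 1 * X ^ m + C 1 * X ^ b + C 1 * X ^ a + C (-1) * X ^ 0 := by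
    simp [intQuad, sub_eq_add_neg]
  rw [mirror, natTrailingDegree_intQuad ha hab hbm, reverse, natDegree_intQuad ha hab hbm, h]
  simp only [reflect_add, reflect_C_mul_X_pow]
  rw [revAt_le le_rfl, revAt_le hbm.le, revAt_le (hab.trans hbm).le, revAt_le (Nat.zero_le m)]
  simp [sub_eq_add_neg]

/-- The product of `intQuad a b m` with its mirror determines the exponents. -/
lemma intQuad_exponents_unique {n : ℕ} (ha : 0 < a) (hab : a < b) (hbm : b < m) (hn : 3 ≤ n)
    (hm : n + (n - 1) ≤ m)
    (h : intQuad a b m * (intQuad a b m).mirror = intQuad 1 n m * (intQuad 1 n m).mirror) :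
    a = 1 ∧ b = n := by
  rw [mirror_intQuad ha hab hbm, mirror_intQuad one_pos (by omega) (by omega)] at h
  simp only [intQuad, add_mul, sub_mul, mul_add, mul_sub, ← pow_add, mul_one, one_mul] at h
  have ha1 : a = 1 := by
    have h1 := congr_arg (fun p => coeff p 1) h
    simp only [coeff_add, coeff_sub, coeff_X_pow, coeff_one] at h1
    clear h
    grind (splits := 40)
  subst ha1
  refine ⟨rfl, ?_⟩
  have hsq : ∀ e : ℕ, eval 1 (derivative (X * derivative (X ^ e : ℤ[X]))) = (e : ℤ) ^ 2 := by
    rintro (_ | e)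
    · simp
    · simp [derivative_X_pow]
      ring
  have h1 := congr_arg (fun p => eval 1 (derivative (X * derivative p))) h
  simp only [derivative_add, derivative_sub, mul_add, mul_sub, eval_add, eval_sub, hsq,
    derivative_one, mul_zero, derivative_zero, eval_zero] at h1
  push_cast [Nat.cast_sub hbm.le, Nat.cast_sub (show n ≤ m by omega),
    Nat.cast_sub (show 1 ≤ m by omega)] at h1
  have h2 : ((b : ℤ) - n) * (2 * m + 2 - b - n) = 0 := by linarith
  rcases mul_eq_zero.1 h2 with h3 | h3 <;> omega

/-- An integer polynomial whose squared coefficients sum to `4` and whose constant coefficient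
is nonzero has four coefficients `±1`, provided its degree is positive. -/
lemma exists_eq_of_sum_sq_eq_four {k : ℤ[X]} (hm : 0 < k.natDegree) (h0 : k.coeff 0 ≠ 0)
    (hs : (k.sum fun _ => (· ^ 2)) = 4) :
    ∃ a b, ∃ c₀ c₁ c₂ c₃ : ℤ, 0 < a ∧ a < b ∧ b < k.natDegree ∧
      (c₀ = 1 ∨ c₀ = -1) ∧ (c₁ = 1 ∨ c₁ = -1) ∧ (c₂ = 1 ∨ c₂ = -1) ∧ (c₃ = 1 ∨ c₃ = -1) ∧
      c₀ = k.coeff 0 ∧ c₃ = k.leadingCoeff ∧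
      k = C c₃ * X ^ k.natDegree + C c₂ * X ^ b + C c₁ * X ^ a + C c₀ := by
  classical
  set m := k.natDegree with hmdef
  have hk : k ≠ 0 := by rintro rfl; simp at h0
  have h0s : 0 ∈ k.support := mem_support_iff.2 h0
  have hms : m ∈ k.support := natDegree_mem_support_of_nonzero hk
  rw [sum_def] at hs
  have key : ∀ i ∈ k.support, k.coeff i ^ 2 = 1 := by
    intro i hi
    obtain ⟨j, hj, hij⟩ : ∃ j ∈ k.support, i ≠ j := by
      by_cases h : i = 0
      · exact ⟨m, hms, by omega⟩
      · exact ⟨0, h0s, h⟩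
    have hsub : ({i, j} : Finset ℕ) ⊆ k.support := by
      intro x hx
      simp only [Finset.mem_insert, Finset.mem_singleton] at hx
      rcases hx with rfl | rfl <;> assumption
    have hle := Finset.sum_le_sum_of_subset_of_nonneg (f := fun i => k.coeff i ^ 2) hsub
      (fun _ _ _ => sq_nonneg _)
    rw [Finset.sum_pair hij, hs] at hle
    have hjpos : 0 < k.coeff j ^ 2 := by have := mem_support_iff.1 hj; positivity
    exact Int.sq_eq_one_of_sq_le_three (by omega) (mem_support_iff.1 hi)
  have hcard : k.support.card = 4 := by
    rw [Finset.sum_congr rfl key] at hs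
    rw [Finset.sum_const, Nat.smul_one_eq_cast] at hs
    exact_mod_cast hs
  have hms' : m ∈ k.support.erase 0 := Finset.mem_erase.2 ⟨hm.ne', hms⟩
  have h2 : ((k.support.erase 0).erase m).card = 2 := by
    rw [Finset.card_erase_of_mem hms', Finset.card_erase_of_mem h0s, hcard]
  obtain ⟨a, b, hab, he⟩ : ∃ a b, a < b ∧ (k.support.erase 0).erase m = {a, b} := by
    obtain ⟨a, b, hab, he⟩ := Finset.card_eq_two.1 h2
    rcases hab.lt_or_gt with h | h
    · exact ⟨a, b, h, he⟩
    · exact ⟨b, a, h, by rw [he, Finset.pair_comm]⟩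
  have hma : a ∈ (k.support.erase 0).erase m := by simp [he]
  have hmb : b ∈ (k.support.erase 0).erase m := by simp [he]
  simp only [Finset.mem_erase] at hma hmb
  have hbm : b ≤ m := le_natDegree_of_mem_supp b hmb.2.2
  refine ⟨a, b, k.coeff 0, k.coeff a, k.coeff b, k.leadingCoeff, by omega, hab, by omega,
    sq_eq_one_iff.1 (key 0 h0s), sq_eq_one_iff.1 (key a hma.2.2),
    sq_eq_one_iff.1 (key b hmb.2.2), sq_eq_one_iff.1 (key m hms), rfl, rfl, ?_⟩
  conv_lhs => rw [k.as_sum_support_C_mul_X_pow]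
  rw [← Finset.add_sum_erase _ _ h0s, ← Finset.add_sum_erase _ _ hms', he, Finset.sum_pair hab.ne,
    leadingCoeff]
  simp only [pow_zero, mul_one]
  ring

lemma eq_of_mul_mirror_eq {n : ℕ} (hn : 3 ≤ n) (hm : n + (n - 1) ≤ m) (k : ℤ[X])
    (h : intQuad 1 n m * (intQuad 1 n m).mirror = k * k.mirror) :
    k = intQuad 1 n m ∨ k = -intQuad 1 n m ∨
      k = (intQuad 1 n m).mirror ∨ k = -(intQuad 1 n m).mirror := by
  have h1n : 1 < n := by omega
  have hnm : n < m := by omega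
  have hdeg : k.natDegree = m := by
    have := congr_arg natDegree h
    rw [natDegree_mul_mirror, natDegree_mul_mirror, natDegree_intQuad one_pos h1n hnm] at this
    omega
  have htr : k.natTrailingDegree = 0 := by
    have := congr_arg natTrailingDegree h
    rw [natTrailingDegree_mul_mirror, natTrailingDegree_mul_mirror,
      natTrailingDegree_intQuad one_pos h1n hnm] at this
    omega
  have hk0 : k ≠ 0 := by rintro rfl; simp at hdeg; omega
  have hc0 : k.coeff 0 ≠ 0 := by
    rcases natTrailingDegree_eq_zero.1 htr with h' | h'
    · exact absurd h' hk0
    · exact h'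
  have hlead : k.leadingCoeff * k.coeff 0 = -1 := by
    have := congr_arg leadingCoeff h
    rw [leadingCoeff_mul, leadingCoeff_mul, mirror_leadingCoeff, mirror_leadingCoeff, trailingCoeff,
      trailingCoeff, htr, natTrailingDegree_intQuad one_pos h1n hnm,
      coeff_zero_intQuad one_pos h1n hnm, leadingCoeff_intQuad one_pos h1n hnm] at this
    omega
  have heval : k.eval 1 ^ 2 = 4 := by
    have := congr_arg (eval 1) h
    rw [eval_mul, eval_mul, mirror_eval_one, mirror_eval_one, ← sq, ← sq] at this
    rw [← this]
    norm_num [intQuad]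
  have hsum : (k.sum fun _ => (· ^ 2)) = 4 := by
    have h1 := coeff_mul_mirror k
    rw [hdeg, htr, add_zero, ← h, mirror_intQuad one_pos h1n hnm] at h1
    rw [← h1]
    simp only [intQuad, add_mul, sub_mul, mul_add, mul_sub, ← pow_add, mul_one, one_mul, coeff_add,
      coeff_sub, coeff_X_pow, coeff_one]
    clear h h1
    grind (splits := 40)
  obtain ⟨a, b, c₀, c₁, c₂, c₃, ha, hab, hbm, h₀, h₁, h₂, h₃, h₀', h₃', hk⟩ :=
    exists_eq_of_sum_sq_eq_four (by omega) hc0 hsum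
  rw [hdeg] at hbm hk
  rw [← h₀', ← h₃'] at hlead
  have hpos : ∀ a b, 0 < a → a < b → b < m →
      intQuad a b m * (intQuad a b m).mirror = k * k.mirror → intQuad a b m = intQuad 1 n m := by
    intro a b ha hab hbm h'
    obtain ⟨rfl, rfl⟩ := intQuad_exponents_unique ha hab hbm hn hm (h'.trans h.symm)
    rfl
  have hmir : (intQuad (m - b) (m - a) m).mirror = 1 + X ^ a + X ^ b - X ^ m := by
    rw [mirror_intQuad (by omega) (by omega) (by omega), Nat.sub_sub_self (by omega),
      Nat.sub_sub_self (by omega)]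
  have hcases : k = intQuad a b m ∨ k = -intQuad a b m ∨
      k = (intQuad (m - b) (m - a) m).mirror ∨ k = -(intQuad (m - b) (m - a) m).mirror := by
    rw [hk] at heval
    simp only [eval_add, eval_mul, eval_C, eval_pow, eval_X, one_pow, mul_one] at heval
    rw [hmir, intQuad, hk]
    clear hk h₀' h₃'
    rcases h₀ with rfl | rfl <;> rcases h₁ with rfl | rfl <;> rcases h₂ with rfl | rfl <;>
      rcases h₃ with rfl | rfl <;> try (norm_num at heval; done)
    all_goals try (norm_num at hlead; done)
    · right; right; left; simp; ring
    · right; left; simp; ring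
    · left; simp; ring
    · right; right; right; simp; ring
  rcases hcases with h' | h' | h' | h'
  · left
    rw [h']
    exact hpos a b ha hab hbm (by rw [h'])
  · right; left
    rw [h', hpos a b ha hab hbm (by rw [h', mirror_neg, neg_mul_neg])]
  · right; right; left
    rw [h', hpos (m - b) (m - a) (by omega) (by omega) (by omega)
      (by rw [h', mirror_mirror, mul_comm])]
  · right; right; right
    rw [h', hpos (m - b) (m - a) (by omega) (by omega) (by omega)
      (by rw [h', mirror_neg, neg_mul_neg, mirror_mirror, mul_comm])]

end intQuad

lemma two_mul_gcd_dvd_of_pow_eq {z : ℂ} {a b : ℕ} (ha : z ^ a = 1) (hb : z ^ b = -1) :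
    2 * Nat.gcd a b ∣ a := by
  obtain ⟨a', ha'⟩ := Nat.gcd_dvd_left a b
  obtain ⟨b', hb'⟩ := Nat.gcd_dvd_right a b
  set g := Nat.gcd a b
  rcases Nat.even_or_odd a' with ⟨c, hc⟩ | hodd
  · exact ⟨c, by rw [ha', hc]; ring⟩
  · exfalso
    have h : (z ^ b) ^ a' = (z ^ a) ^ b' := by
      rw [← pow_mul, ← pow_mul]
      congr 1
      rw [ha', hb']
      ring
    rw [ha, hb, hodd.neg_one_pow, one_pow] at h
    norm_num at h

lemma X_pow_gcd_add_one_dvd {R : Type*} [CommRing R] {a b : ℕ} (ha : 0 < a)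
    (h : 2 * Nat.gcd a b ∣ a) :
    (X ^ Nat.gcd a b + 1 : R[X]) ∣ X ^ a - 1 ∧ (X ^ Nat.gcd a b + 1 : R[X]) ∣ X ^ b + 1 := by
  have hg : 0 < Nat.gcd a b := Nat.gcd_pos_of_pos_left b ha
  obtain ⟨b', hb'⟩ := Nat.gcd_dvd_right a b
  have hodd : Odd b' := by
    rw [← Nat.not_even_iff_odd]
    rintro ⟨c, hc⟩
    have : 2 * Nat.gcd a b ∣ Nat.gcd a b :=
      Nat.dvd_gcd h ⟨c, by rw [hc] at hb'; linarith⟩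
    have := Nat.le_of_dvd hg this
    omega
  constructor
  · obtain ⟨c, hc⟩ := h
    have h1 : (X ^ Nat.gcd a b + 1 : R[X]) ∣ X ^ (2 * Nat.gcd a b) - 1 :=
      ⟨X ^ Nat.gcd a b - 1, by ring⟩
    refine h1.trans ?_
    have h2 := sub_dvd_pow_sub_pow (X ^ (2 * Nat.gcd a b) : R[X]) 1 c
    rwa [one_pow, ← pow_mul, ← hc] at h2
  · have h2 := hodd.add_dvd_pow_add_pow (X ^ Nat.gcd a b : R[X]) 1
    rwa [one_pow, ← pow_mul, ← hb'] at h2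

lemma not_irreducible_of_X_pow_add_one_dvd {K : Type*} [Field K] {p : K[X]} {g : ℕ} (hg : 0 < g)
    (hp : g < p.natDegree) (h : X ^ g + 1 ∣ p) : ¬ Irreducible p := by
  intro hirr
  have hdeg : (X ^ g + 1 : K[X]).natDegree = g := by
    simpa using natDegree_X_pow_add_C (n := g) (r := (1 : K))
  have hu : ¬ IsUnit (X ^ g + 1 : K[X]) := fun hu => by
    have := natDegree_eq_zero_of_isUnit hu
    omega
  have := natDegree_eq_of_degree_eq
    (degree_eq_degree_of_associated ((hirr.dvd_iff.1 h).resolve_left hu))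
  omega

lemma pow_eq_of_common_root {n m : ℕ} (hn : 1 < n) (hm : n < m) {z : ℂ}
    (h₁ : z ^ m + z ^ n + z - 1 = 0) (h₂ : 1 + z ^ (m - n) + z ^ (m - 1) - z ^ m = 0) :
    (z ^ m = 1 ∧ z ^ (n - 1) = -1) ∨ (z ^ n = 1 ∧ z ^ (m - 1) = -1) := by
  have hz : z ≠ 0 := by
    rintro rfl
    rw [zero_pow (by omega), zero_pow (by omega)] at h₁
    norm_num at h₁
  have e₁ : z ^ (m - n) * z ^ n = z ^ m := by rw [← pow_add]; congr 1; omega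
  have e₂ : z ^ (m - 1) * z = z ^ m := by rw [← pow_succ]; congr 1; omega
  have e₃ : z ^ (n - 1) * z = z ^ n := by rw [← pow_succ]; congr 1; omega
  have hprod : (1 - z ^ m) * ((1 - z ^ n) * (1 - z)) = 0 := by
    linear_combination (-1 : ℂ) * h₁ + z ^ n * z * h₂ - z * e₁ - z ^ n * e₂
  rcases mul_eq_zero.1 hprod with h | h
  · refine Or.inl ⟨by linear_combination -h, mul_right_cancel₀ hz ?_⟩
    linear_combination e₃ + h₁ + h
  rcases mul_eq_zero.1 h with h | h
  · refine Or.inr ⟨by linear_combination -h, mul_right_cancel₀ hz ?_⟩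
    linear_combination e₂ + h₁ + h
  · have : z = 1 := by linear_combination -h
    subst this
    norm_num at h₁

lemma isRelPrime_of_no_common_root {p q : ℤ[X]} (hp : IsUnit p.leadingCoeff)
    (h : ∀ z : ℂ, aeval z p = 0 → aeval z q ≠ 0) : IsRelPrime p q := by
  intro d hdp hdq
  have hlead : IsUnit d.leadingCoeff := isUnit_of_dvd_unit (leadingCoeff_dvd_leadingCoeff hdp) hp
  by_cases hd : d.natDegree = 0
  · rw [eq_C_of_natDegree_eq_zero hd]
    rw [leadingCoeff, hd] at hlead
    exact isUnit_C.2 hlead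
  · exfalso
    have hinj : Function.Injective (algebraMap ℤ ℂ) := RingHom.injective_int _
    obtain ⟨z, hz⟩ := IsAlgClosed.exists_aeval_eq_zero_of_injective ℂ hinj d (by
      intro h0
      exact hd (natDegree_eq_of_degree_eq_some h0))
    exact h z (aeval_eq_zero_of_dvd_aeval_eq_zero hdp hz)
      (aeval_eq_zero_of_dvd_aeval_eq_zero hdq hz)

lemma map_intQuad_one (n m : ℕ) : (intQuad 1 n m).map (algebraMap ℤ ℚ) = quad n m := by
  simp [intQuad, quad]
  ring

/-- **Finch–Jones.** The quadrinomial `f = -1 + x + x^n + x^{m₁} ∈ B` is irreducible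
over `ℚ` if and only if `m₁ ≢ 0 (mod 2e₁)` and `n ≢ 0 (mod 2e₂)`, where
`e₁ = gcd(m₁, n-1)` and `e₂ = gcd(n, m₁-1)`. -/
theorem finch_jones_quadrinomial (n m : ℕ) (hn : 3 ≤ n) (hm : n + (n - 1) ≤ m) :
    Irreducible (quad n m) ↔
      ¬ (2 * Nat.gcd m (n - 1) ∣ m) ∧ ¬ (2 * Nat.gcd n (m - 1) ∣ n) := by
  have h1n : 1 < n := by omega
  have hnm : n < m := by omega
  have hmonic : (intQuad 1 n m).Monic := leadingCoeff_intQuad one_pos h1n hnm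
  have hdeg : (quad n m).natDegree = m := by
    rw [← map_intQuad_one, hmonic.natDegree_map, natDegree_intQuad one_pos h1n hnm]
  constructor
  · refine fun hirr => ⟨fun h => ?_, fun h => ?_⟩
    · obtain ⟨h₁, h₂⟩ := X_pow_gcd_add_one_dvd (R := ℚ) (by omega) h
      have hle := Nat.gcd_le_right m (n := n - 1) (by omega)
      refine not_irreducible_of_X_pow_add_one_dvd (g := Nat.gcd m (n - 1))
        (Nat.gcd_pos_of_pos_left (n - 1) (by omega)) (by omega) ?_ hirr
      have : quad n m = (X ^ m - 1) + X * (X ^ (n - 1) + 1) := by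
        rw [quad, mul_add, ← pow_succ', Nat.sub_add_cancel (by omega)]
        ring
      rw [this]
      exact dvd_add h₁ (h₂.mul_left X)
    · obtain ⟨h₁, h₂⟩ := X_pow_gcd_add_one_dvd (R := ℚ) (by omega) h
      have hle := Nat.gcd_le_left (m - 1) (m := n) (by omega)
      refine not_irreducible_of_X_pow_add_one_dvd (g := Nat.gcd n (m - 1))
        (Nat.gcd_pos_of_pos_left (m - 1) (by omega)) (by omega) ?_ hirr
      have : quad n m = (X ^ n - 1) + X * (X ^ (m - 1) + 1) := by
        rw [quad, mul_add, ← pow_succ', Nat.sub_add_cancel (by omega)]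
        ring
      rw [this]
      exact dvd_add h₁ (h₂.mul_left X)
  · rintro ⟨hm', hn'⟩
    rw [← map_intQuad_one, ← hmonic.irreducible_iff_irreducible_map_fraction_map]
    refine irreducible_of_mirror ?_ (eq_of_mul_mirror_eq hn hm) ?_
    · intro hu
      have := natDegree_eq_zero_of_isUnit hu
      rw [natDegree_intQuad one_pos h1n hnm] at this
      omega
    · refine isRelPrime_of_no_common_root (by rw [hmonic.leadingCoeff]; exact isUnit_one) ?_
      intro z hz hz'
      rw [mirror_intQuad one_pos h1n hnm] at hz'
      simp only [intQuad, map_add, map_sub, map_pow, aeval_X, map_one, pow_one] at hz hz'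
      rcases pow_eq_of_common_root h1n hnm hz hz' with ⟨h₁, h₂⟩ | ⟨h₁, h₂⟩
      · exact hm' (two_mul_gcd_dvd_of_pow_eq h₁ h₂)
      · exact hn' (two_mul_gcd_dvd_of_pow_eq h₁ h₂)
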